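/- Suppose a non-elementary group G acts geometrically (properly and cocompactly) by isometries on a proper geodesic metric space (X,d) that is a Morse local-to-global space and contains a Morse geodesic ray, and let H < G be a stable subgroup of infinite index. Then there exists a Morse element g ∈ G such that for every C ≥ 0 the set {k ∈ ℤ : there exists h ∈ H with d(h·o, g^k·o) ≤ C} is finite (this is the metric formulation of Fix_{∂_M X}(g) ∩ Λ_M H = ∅). -/

import Mathlib

open Metric Set Filter Pointwise

/-- `γ` restricted to `[0, L]` is a `(lam, c)`-quasi-geodesic parametrized by arc length:
the length of the subpath from `s` to `t` is `t - s`. -/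
def IsQuasiGeodesicOn {X : Type*} [MetricSpace X] (γ : ℝ → X) (L lam c : ℝ) : Prop :=
  (∀ s t : ℝ, 0 ≤ s → s ≤ t → t ≤ L → dist (γ s) (γ t) ≤ t - s) ∧
  (∀ s t : ℝ, 0 ≤ s → s ≤ t → t ≤ L → t - s ≤ lam * dist (γ s) (γ t) + c)

/-- `γ` restricted to `[0, L]` is a geodesic (unit speed). -/
def IsGeodesicOn {X : Type*} [MetricSpace X] (γ : ℝ → X) (L : ℝ) : Prop :=
  ∀ s t : ℝ, s ∈ Set.Icc 0 L → t ∈ Set.Icc 0 L → dist (γ s) (γ t) = |s - t|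

/-- A metric space is geodesic if any two points are joined by a geodesic. -/
def GeodesicSpace (X : Type*) [MetricSpace X] : Prop :=
  ∀ x y : X, ∃ γ : ℝ → X, γ 0 = x ∧ γ (dist x y) = y ∧ IsGeodesicOn γ (dist x y)

/-- The path `γ` on `[0, L]` is `M`-Morse: every `(lam, c)`-quasi-geodesic with endpoints
on `γ` stays within distance `M lam c` of the corresponding subpath of `γ`. -/
def IsMorseOn {X : Type*} [MetricSpace X] (γ : ℝ → X) (L : ℝ) (M : ℝ → ℝ → ℝ) : Prop :=
  ∀ lam c : ℝ, 1 ≤ lam → 0 ≤ c →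
    ∀ (β : ℝ → X) (Lβ : ℝ), 0 ≤ Lβ → IsQuasiGeodesicOn β Lβ lam c →
      ∀ s t : ℝ, 0 ≤ s → s ≤ t → t ≤ L → β 0 = γ s → β Lβ = γ t →
        ∀ u ∈ Set.Icc (0:ℝ) Lβ, ∃ v ∈ Set.Icc s t, dist (β u) (γ v) ≤ M lam c

/-- `γ` on `[0, Lγ]` is an `(L; M; lam, c)`-local Morse quasi-geodesic: every subpath of
length at most `L` is an `(M; lam, c)`-Morse quasi-geodesic. -/
def LocalMorseQuasiGeodesicOn {X : Type*} [MetricSpace X] (γ : ℝ → X) (Lγ L : ℝ)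
    (M : ℝ → ℝ → ℝ) (lam c : ℝ) : Prop :=
  ∀ s t : ℝ, 0 ≤ s → s ≤ t → t ≤ Lγ → t - s ≤ L →
    IsQuasiGeodesicOn (fun u => γ (s + u)) (t - s) lam c ∧
    IsMorseOn (fun u => γ (s + u)) (t - s) M

/-- Morse local-to-global space. -/
def MorseLocalToGlobalSpace (X : Type*) [MetricSpace X] : Prop :=
  ∀ (M : ℝ → ℝ → ℝ) (lam c : ℝ), 1 ≤ lam → 0 ≤ c →
    ∃ (M' : ℝ → ℝ → ℝ) (L lam' c' : ℝ), 0 ≤ L ∧ 1 ≤ lam' ∧ 0 ≤ c' ∧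
      ∀ (γ : ℝ → X) (Lγ : ℝ), 0 ≤ Lγ → LocalMorseQuasiGeodesicOn γ Lγ L M lam c →
        IsQuasiGeodesicOn γ Lγ lam' c' ∧ IsMorseOn γ Lγ M'

/-- A Morse geodesic ray: an isometric embedding of `[0, ∞)` which is `M`-Morse. -/
def IsMorseGeodesicRay {X : Type*} [MetricSpace X] (γ : ℝ → X) (M : ℝ → ℝ → ℝ) : Prop :=
  (∀ s t : ℝ, 0 ≤ s → 0 ≤ t → dist (γ s) (γ t) = |s - t|) ∧
  (∀ lam c : ℝ, 1 ≤ lam → 0 ≤ c →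
    ∀ (β : ℝ → X) (Lβ : ℝ), 0 ≤ Lβ → IsQuasiGeodesicOn β Lβ lam c →
      ∀ s t : ℝ, 0 ≤ s → s ≤ t → β 0 = γ s → β Lβ = γ t →
        ∀ u ∈ Set.Icc (0:ℝ) Lβ, ∃ v ∈ Set.Icc s t, dist (β u) (γ v) ≤ M lam c)

/-- The action of `G` on `X` is by isometries. -/
def IsometricAction (G X : Type*) [Group G] [MetricSpace X] [MulAction G X] : Prop :=
  ∀ (g : G) (x y : X), dist (g • x) (g • y) = dist x y

/-- The action of `G` on `X` is (metrically) proper. -/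
def ProperAction (G X : Type*) [Group G] [MetricSpace X] [MulAction G X] : Prop :=
  ∀ (x : X) (r : ℝ), 0 < r → {g : G | dist x (g • x) ≤ r}.Finite

/-- The action of `G` on `X` is cocompact. -/
def CocompactAction (G X : Type*) [Group G] [MetricSpace X] [MulAction G X] : Prop :=
  ∃ K : Set X, IsCompact K ∧ ∀ x : X, ∃ g : G, g • x ∈ K

/-- `H` is a stable subgroup: there are a Morse gauge `M` and `D ≥ 0` such that every
geodesic `[o, h • o]` is `M`-Morse and contained in the `D`-neighborhood of `H • o`. -/
def IsStableSubgroup {X G : Type*} [MetricSpace X] [Group G] [MulAction G X]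
    (o : X) (H : Subgroup G) : Prop :=
  ∃ (M : ℝ → ℝ → ℝ) (D : ℝ), 0 ≤ D ∧
    ∀ h ∈ H, ∀ γ : ℝ → X, γ 0 = o → γ (dist o (h • o)) = h • o →
      IsGeodesicOn γ (dist o (h • o)) →
      IsMorseOn γ (dist o (h • o)) M ∧
      ∀ s ∈ Set.Icc 0 (dist o (h • o)), ∃ h' ∈ H, dist (γ s) (h' • o) ≤ D

/-- A Morse element: an infinite order element generating a stable cyclic subgroup. -/
def IsMorseElement {X G : Type*} [MetricSpace X] [Group G] [MulAction G X]
    (o : X) (g : G) : Prop :=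
  ¬ IsOfFinOrder g ∧ IsStableSubgroup o (Subgroup.zpowers g)

/-- `H` is quasi-convex: geodesics with endpoints on `H • o` stay in a `σ`-neighborhood
of `H • o`. -/
def IsQuasiConvexSubgroup {X G : Type*} [MetricSpace X] [Group G] [MulAction G X]
    (o : X) (H : Subgroup G) : Prop :=
  ∃ σ : ℝ, 0 ≤ σ ∧ ∀ h h' : G, h ∈ H → h' ∈ H →
    ∀ γ : ℝ → X, γ 0 = h • o → γ (dist (h • o) (h' • o)) = h' • o →
      IsGeodesicOn γ (dist (h • o) (h' • o)) →
      ∀ s ∈ Set.Icc 0 (dist (h • o) (h' • o)), ∃ h'' ∈ H, dist (γ s) (h'' • o) ≤ σ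

/-- The growth rate `ω(A) = limsup (log #(B(n) ∩ A)) / n` of a subset `A ⊆ G`. -/
noncomputable def growthRate {X G : Type*} [MetricSpace X] [Group G] [MulAction G X]
    (o : X) (A : Set G) : ℝ :=
  Filter.limsup (fun n : ℕ =>
    Real.log ((A ∩ {g : G | dist o (g • o) ≤ (n : ℝ)}).ncard) / (n : ℝ)) Filter.atTop

/-- Convergence of the Poincaré series `𝒫_A(s) = Σ_{g ∈ A} exp (-s · d_G(1, g))`. -/
def PoincareSummable {X G : Type*} [MetricSpace X] [Group G] [MulAction G X]
    (o : X) (A : Set G) (s : ℝ) : Prop :=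
  Summable fun g : A => Real.exp (-s * dist o ((g : G) • o))

/-- A group is virtually cyclic if it has a cyclic subgroup of finite index. -/
def VirtuallyCyclic (G : Type*) [Group G] : Prop :=
  ∃ H : Subgroup G, IsCyclic H ∧ H.FiniteIndex

/-- The annulus set `𝒜(n, Δ) = {h ∈ H : |d_G(1,h) - n| ≤ Δ}`. -/
def annulus {X G : Type*} [MetricSpace X] [Group G] [MulAction G X]
    (o : X) (H : Subgroup G) (n Δ : ℝ) : Set G :=
  {h : G | h ∈ H ∧ |dist o (h • o) - n| ≤ Δ}

/-- Evaluation of a formal alternating word `a₁b₁a₂b₂⋯aₙbₙ` in `G`. -/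
def evalWord {G : Type*} [Group G] (w : List (G × G)) : G :=
  (w.map fun p => p.1 * p.2).prod

/-- The set `𝕎(A, B)` of (nonempty) formal alternating words with letters in `A` and `B`. -/
def AltWords {G : Type*} [Group G] (A B : Set G) : Set (List (G × G)) :=
  {w | w ≠ [] ∧ ∀ p ∈ w, p.1 ∈ A ∧ p.2 ∈ B}

/-- The nearest-point projection `π_A(x)` of a point to a subset `A ⊆ X`. -/
def projSet {X : Type*} [MetricSpace X] (A : Set X) (x : X) : Set X :=
  {a ∈ A | dist x a = Metric.infDist x A}

/-- The projection `π_A(Y) = ⋃_{y ∈ Y} π_A(y)` of a subset `Y` to `A`. -/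
def projSetOf {X : Type*} [MetricSpace X] (A Y : Set X) : Set X :=
  ⋃ y ∈ Y, projSet A y

/-- `f` is `1`-Lipschitz on `[a, b]`. -/
def IsShortOn {X : Type*} [MetricSpace X] (f : ℝ → X) (a b : ℝ) : Prop :=
  ∀ s t : ℝ, a ≤ s → s ≤ t → t ≤ b → dist (f s) (f t) ≤ t - s

theorem IsShortOn.trans {X : Type*} [MetricSpace X] {f : ℝ → X} {a b c : ℝ}
    (h₁ : IsShortOn f a b) (h₂ : IsShortOn f b c) : IsShortOn f a c := by
  intro s t hs hst ht
  rcases le_total t b with htb | hbt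
  · exact h₁ s t hs hst htb
  rcases le_total b s with hbs | hsb
  · exact h₂ s t hbs hst ht
  · have h3 := h₁ s b hs hsb le_rfl
    have h4 := h₂ b t le_rfl hbt ht
    have := dist_triangle (f s) (f b) (f t)
    linarith

theorem exists_concat {X : Type*} [MetricSpace X] {f h : ℝ → X} {L₁ L₂ : ℝ}
    (hf : IsShortOn f 0 L₁) (hh : IsShortOn h 0 L₂) (hfh : f L₁ = h 0) :
    ∃ k : ℝ → X, IsShortOn k 0 (L₁ + L₂) ∧ (∀ t, t ≤ L₁ → k t = f t) ∧
      ∀ t, L₁ ≤ t → k t = h (t - L₁) := by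
  have e₁ : ∀ t, t ≤ L₁ → (if t ≤ L₁ then f t else h (t - L₁)) = f t :=
    fun t ht => if_pos ht
  have e₂ : ∀ t, L₁ ≤ t → (if t ≤ L₁ then f t else h (t - L₁)) = h (t - L₁) := by
    intro t ht
    split_ifs with h1
    · obtain rfl := le_antisymm h1 ht
      rw [hfh, sub_self]
    · rfl
  refine ⟨fun t => if t ≤ L₁ then f t else h (t - L₁), ?_, e₁, e₂⟩
  refine IsShortOn.trans (b := L₁) ?_ ?_
  · intro s t hs hst ht
    simp only [e₁ s (hst.trans ht), e₁ t ht]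
    exact hf s t hs hst ht
  · intro s t hs hst ht
    simp only [e₂ s hs, e₂ t (hs.trans hst)]
    have := hh (s - L₁) (t - L₁) (by linarith) (by linarith) (by linarith)
    linarith

theorem IsGeodesicOn.isQuasiGeodesicOn {X : Type*} [MetricSpace X] {γ : ℝ → X} {L : ℝ}
    (h : IsGeodesicOn γ L) : IsQuasiGeodesicOn γ L 1 0 := by
  have key : ∀ s t : ℝ, 0 ≤ s → s ≤ t → t ≤ L → dist (γ s) (γ t) = t - s := by
    intro s t hs hst ht
    rw [h s t ⟨hs, hst.trans ht⟩ ⟨hs.trans hst, ht⟩, abs_sub_comm,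
      abs_of_nonneg (sub_nonneg.2 hst)]
  exact ⟨fun s t hs hst ht => (key s t hs hst ht).le,
    fun s t hs hst ht => by rw [key s t hs hst ht]; linarith⟩

theorem GeodesicSpace.exists_short {X : Type*} [MetricSpace X] (hgeo : GeodesicSpace X)
    {x y : X} {K : ℝ} (hxy : dist x y ≤ K) :
    ∃ η : ℝ → X, η 0 = x ∧ η K = y ∧ IsShortOn η 0 K := by
  obtain ⟨γ, h0, h1, hγ⟩ := hgeo x y
  refine ⟨fun t => γ (min t (dist x y)), ?_, ?_, ?_⟩
  · simp [h0]
  · simp [hxy, h1]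
  · intro s t hs hst _
    have := hγ.isQuasiGeodesicOn.1 (min s (dist x y)) (min t (dist x y))
      (le_min hs dist_nonneg) (min_le_min_right _ hst) (min_le_right _ _)
    refine this.trans ?_
    rcases le_total s (dist x y) with h | h <;> rcases le_total t (dist x y) with h' | h' <;>
      simp [h, h'] <;> linarith

/-- A quasi-geodesic can be prolonged at both ends to nearby endpoints. -/
theorem IsQuasiGeodesicOn.exists_extension {X : Type*} [MetricSpace X] (hgeo : GeodesicSpace X)
    {β : ℝ → X} {L lam c K : ℝ} (hL : 0 ≤ L) (hlam : 1 ≤ lam) (hβ : IsQuasiGeodesicOn β L lam c)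
    {x y : X} (hx : dist (β 0) x ≤ K) (hy : dist (β L) y ≤ K) :
    ∃ β' : ℝ → X, IsQuasiGeodesicOn β' (L + 2 * K) lam (c + 2 * K + 2 * lam * K) ∧
      β' 0 = x ∧ β' (L + 2 * K) = y ∧ (∀ u ∈ Set.Icc 0 L, β' (K + u) = β u) ∧
      ∀ t ∈ Set.Icc 0 (L + 2 * K), ∃ u ∈ Set.Icc 0 L, dist (β' t) (β u) ≤ K := by
  have hK : 0 ≤ K := dist_nonneg.trans hx
  obtain ⟨η, η0, ηK, hη⟩ := hgeo.exists_short (x := x) (y := β 0) (K := K) (by rwa [dist_comm])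
  obtain ⟨ζ, ζ0, ζK, hζ⟩ := hgeo.exists_short hy
  obtain ⟨k, hk, k₁, k₂⟩ := exists_concat (h := β) (L₂ := L) hη hβ.1 ηK
  obtain ⟨l, hl, l₁, l₂⟩ := exists_concat (h := ζ) (L₂ := K) hk hζ
    (by rw [k₂ _ (by linarith), ζ0]; congr 1; ring)
  have hmid : ∀ u ∈ Set.Icc 0 L, l (K + u) = β u := by
    rintro u ⟨h0, h1⟩
    rw [l₁ _ (by linarith), k₂ _ (by linarith)]
    congr 1; ring
  have hshort : IsShortOn l 0 (L + 2 * K) := by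
    convert hl using 1; ring
  have hclamp : ∀ t ∈ Set.Icc 0 (L + 2 * K), dist (l t) (β (max 0 (min (t - K) L))) ≤ K := by
    rintro t ⟨ht0, ht1⟩
    have hu : max 0 (min (t - K) L) ∈ Set.Icc 0 L :=
      ⟨le_max_left _ _, max_le hL (min_le_right _ _)⟩
    rw [← hmid _ hu]
    rcases le_total t K with h | h
    · have e : max 0 (min (t - K) L) = 0 := by
        rw [max_eq_left]; exact (min_le_left _ _).trans (by linarith)
      rw [e]
      have := hshort t (K + 0) ht0 (by linarith) (by linarith)
      linarith
    rcases le_total (t - K) L with h' | h'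
    · have e : max 0 (min (t - K) L) = t - K := by
        rw [min_eq_left h', max_eq_right (by linarith)]
      rw [e]; simp [hK]
    · have e : max 0 (min (t - K) L) = L := by
        rw [min_eq_right h', max_eq_right hL]
      rw [e, dist_comm]
      have := hshort (K + L) t (by linarith) (by linarith) ht1
      linarith
  refine ⟨l, ⟨hshort, ?_⟩, ?_, ?_, hmid, ?_⟩
  · intro s t hs hst ht
    have h1 := hclamp s ⟨hs, hst.trans ht⟩
    have h2 := hclamp t ⟨hs.trans hst, ht⟩
    set a := max 0 (min (s - K) L) with ha
    set b := max 0 (min (t - K) L) with hb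
    have hab : a ≤ b := max_le_max le_rfl (min_le_min (by linarith) le_rfl)
    have h3 := hβ.2 a b (le_max_left _ _) hab (max_le hL (min_le_right _ _))
    have h4 : dist (β a) (β b) ≤ dist (l s) (l t) + 2 * K := by
      have := dist_triangle4 (β a) (l s) (l t) (β b)
      rw [dist_comm (β a) (l s)] at this
      linarith
    have h5 : t - s ≤ b - a + 2 * K := by
      have ha' : a ≤ max 0 (s - K) := max_le_max le_rfl (min_le_left _ _)
      rcases le_total (t - K) L with h | h
      · have : t - K ≤ b := by rw [hb, min_eq_left h]; exact le_max_right _ _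
        rcases le_total 0 (s - K) with h' | h'
        · rw [max_eq_right h'] at ha'; linarith
        · rw [max_eq_left h'] at ha'; linarith
      · have : L ≤ b := by rw [hb, min_eq_right h]; exact le_max_right _ _
        rcases le_total 0 (s - K) with h' | h'
        · rw [max_eq_right h'] at ha'; linarith
        · rw [max_eq_left h'] at ha'; linarith
    have h6 : lam * dist (β a) (β b) ≤ lam * (dist (l s) (l t) + 2 * K) :=
      mul_le_mul_of_nonneg_left h4 (by linarith)
    linarith
  · rw [l₁ _ (by linarith), k₁ _ hK, η0]
  · rw [l₂ _ (by linarith), ← ζK]; congr 1; ring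
  · exact fun t ht => ⟨_, ⟨le_max_left _ _, max_le hL (min_le_right _ _)⟩, hclamp t ht⟩

theorem IsQuasiGeodesicOn.reverse {X : Type*} [MetricSpace X] {β : ℝ → X} {L lam c : ℝ}
    (hβ : IsQuasiGeodesicOn β L lam c) : IsQuasiGeodesicOn (fun u => β (L - u)) L lam c := by
  constructor
  · intro s t hs hst ht
    have := hβ.1 (L - t) (L - s) (by linarith) (by linarith) (by linarith)
    rw [dist_comm]; linarith
  · intro s t hs hst ht
    have := hβ.2 (L - t) (L - s) (by linarith) (by linarith) (by linarith)
    rw [dist_comm]; linarith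

theorem IsQuasiGeodesicOn.subpath {X : Type*} [MetricSpace X] {β : ℝ → X} {L lam c s t : ℝ}
    (hβ : IsQuasiGeodesicOn β L lam c) (hs : 0 ≤ s) (ht : t ≤ L) :
    IsQuasiGeodesicOn (fun u => β (s + u)) (t - s) lam c := by
  constructor
  · intro a b ha hab hb
    have := hβ.1 (s + a) (s + b) (by linarith) (by linarith) (by linarith)
    linarith
  · intro a b ha hab hb
    have := hβ.2 (s + a) (s + b) (by linarith) (by linarith) (by linarith)
    linarith

theorem IsQuasiGeodesicOn.smul {X G : Type*} [MetricSpace X] [Group G] [MulAction G X]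
    (hiso : IsometricAction G X) (g : G) {β : ℝ → X} {L lam c : ℝ}
    (hβ : IsQuasiGeodesicOn β L lam c) : IsQuasiGeodesicOn (fun u => g • β u) L lam c := by
  simpa only [IsQuasiGeodesicOn, hiso g] using hβ

/-- If a cover of `[0, L]` by two sets contains both endpoints suitably, the two sets come
arbitrarily close to each other. -/
theorem exists_close_of_cover {L : ℝ} (hL : 0 ≤ L) {P Q : ℝ → Prop}
    (h : ∀ u ∈ Set.Icc 0 L, P u ∨ Q u) (h0 : P 0) (h1 : Q L) :
    ∃ u ∈ Set.Icc 0 L, ∃ v ∈ Set.Icc 0 L, P u ∧ Q v ∧ |u - v| ≤ 1 := by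
  set S := {u | u ∈ Set.Icc 0 L ∧ P u} with hS
  have hne : S.Nonempty := ⟨0, ⟨le_rfl, hL⟩, h0⟩
  have hbdd : BddAbove S := ⟨L, fun u hu => hu.1.2⟩
  obtain ⟨u, hu, hlt⟩ := exists_lt_of_lt_csSup hne (show sSup S - 1 / 2 < sSup S by linarith)
  have hu' := le_csSup hbdd hu
  refine ⟨u, hu.1, ?_⟩
  rcases le_total L (u + 1) with h2 | h2
  · refine ⟨L, ⟨hL, le_rfl⟩, hu.2, h1, ?_⟩
    rw [abs_le]; constructor <;> linarith [hu.1.2]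
  · refine ⟨u + 1, ⟨by linarith [hu.1.1], h2⟩, hu.2, ?_, by simp⟩
    refine (h (u + 1) ⟨by linarith [hu.1.1], h2⟩).resolve_left fun hP => ?_
    have := le_csSup hbdd (show u + 1 ∈ S from ⟨⟨by linarith [hu.1.1], h2⟩, hP⟩)
    linarith

/-- `f` is an axis of `g` of period `T`: a `g`-equivariant bi-infinite quasi-geodesic which is
`M`-Morse. -/
structure IsMorseAxis {X G : Type*} [MetricSpace X] [Group G] [MulAction G X]
    (g : G) (f : ℝ → X) (T : ℝ) (M : ℝ → ℝ → ℝ) (A B : ℝ) : Prop where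
  period_pos : 0 < T
  one_le : 1 ≤ A
  equivariant : ∀ t, f (t + T) = g • f t
  dist_le : ∀ a b, a ≤ b → dist (f a) (f b) ≤ b - a
  le_dist : ∀ a b, a ≤ b → b - a ≤ A * dist (f a) (f b) + B
  morse : ∀ lam c : ℝ, 1 ≤ lam → 0 ≤ c → ∀ (β : ℝ → X) (L : ℝ), 0 ≤ L →
    IsQuasiGeodesicOn β L lam c → ∀ a b, a ≤ b → β 0 = f a → β L = f b →
      ∀ u ∈ Set.Icc 0 L, ∃ v ∈ Set.Icc a b, dist (β u) (f v) ≤ M lam c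

namespace IsMorseAxis

variable {X G : Type*} [MetricSpace X] [Group G] [MulAction G X]
  {g : G} {f : ℝ → X} {T : ℝ} {M : ℝ → ℝ → ℝ} {A B : ℝ}

theorem equivariant_nat (h : IsMorseAxis g f T M A B) (n : ℕ) (t : ℝ) :
    f (t + n * T) = g ^ n • f t := by
  induction n with
  | zero => simp
  | succ n ih =>
    rw [pow_succ', mul_smul, ← ih, ← h.equivariant]
    congr 1; push_cast; ring

theorem equivariant_int (h : IsMorseAxis g f T M A B) (n : ℤ) (t : ℝ) :
    f (t + n * T) = g ^ n • f t := by
  obtain ⟨n, rfl | rfl⟩ := n.eq_nat_or_neg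
  · simpa using h.equivariant_nat n t
  · rw [zpow_neg, eq_inv_smul_iff, zpow_natCast, ← h.equivariant_nat]
    congr 1; push_cast; ring

theorem conj (hiso : IsometricAction G X) (h : IsMorseAxis g f T M A B) (x : G) :
    IsMorseAxis (x * g * x⁻¹) (fun t => x • f t) T M A B where
  period_pos := h.period_pos
  one_le := h.one_le
  equivariant t := by simp [h.equivariant, mul_smul]
  dist_le a b hab := by rw [hiso]; exact h.dist_le a b hab
  le_dist a b hab := by rw [hiso]; exact h.le_dist a b hab
  morse lam c hlam hc β L hL hβ a b hab h0 h1 u hu := by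
    obtain ⟨v, hv, hd⟩ := h.morse lam c hlam hc _ L hL (hβ.smul hiso x⁻¹) a b hab
      (by simp [h0]) (by simp [h1]) u hu
    refine ⟨v, hv, ?_⟩
    rw [← hiso x⁻¹]; simpa using hd

/-- Points of the axis are close to any path with the same endpoints that stays near the axis. -/
theorem exists_dist_le_of_near (h : IsMorseAxis g f T M A B) {β : ℝ → X} {L N a b : ℝ}
    (hL : 0 ≤ L) (hβ : IsShortOn β 0 L) (h0 : β 0 = f a) (h1 : β L = f b)
    (hnear : ∀ u ∈ Set.Icc 0 L, ∃ v ∈ Set.Icc a b, dist (β u) (f v) ≤ N)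
    {w : ℝ} (hw : w ∈ Set.Icc a b) :
    ∃ u ∈ Set.Icc 0 L, dist (f w) (β u) ≤ N + A * (2 * N + 1) + B := by
  have hA := h.one_le
  have hN : 0 ≤ N := by
    obtain ⟨v, -, hv⟩ := hnear 0 ⟨le_rfl, hL⟩
    exact dist_nonneg.trans hv
  obtain ⟨u, hu, v, hv, ⟨p, hp, hpu⟩, ⟨q, hq, hqv⟩, huv⟩ := exists_close_of_cover hL
    (P := fun u => ∃ p ≤ w, dist (β u) (f p) ≤ N) (Q := fun u => ∃ p ≥ w, dist (β u) (f p) ≤ N)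
    (fun u hu => by
      obtain ⟨v, -, hv⟩ := hnear u hu
      rcases le_total v w with hvw | hvw
      · exact Or.inl ⟨v, hvw, hv⟩
      · exact Or.inr ⟨v, hvw, hv⟩)
    ⟨a, hw.1, by rw [h0, dist_self]; exact hN⟩ ⟨b, hw.2, by rw [h1, dist_self]; exact hN⟩
  refine ⟨u, hu, ?_⟩
  have hd : dist (β u) (β v) ≤ 1 := by
    rcases le_total u v with h2 | h2
    · have := hβ u v hu.1 h2 hv.2
      linarith [(abs_le.1 huv).1]
    · have := hβ v u hv.1 h2 hu.2
      rw [dist_comm]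
      linarith [(abs_le.1 huv).2]
  have h3 : dist (f p) (f q) ≤ 2 * N + 1 := by
    have := dist_triangle4 (f p) (β u) (β v) (f q)
    rw [dist_comm (f p) (β u)] at this
    linarith
  have h4 := h.le_dist p q (hp.trans hq)
  have h5 : A * dist (f p) (f q) ≤ A * (2 * N + 1) :=
    mul_le_mul_of_nonneg_left h3 (by linarith)
  have h6 := h.dist_le p w hp
  have h7 := dist_triangle (f w) (f p) (β u)
  rw [dist_comm (f w) (f p), dist_comm (f p) (β u)] at h7
  have : q ≥ w := hq
  linarith

theorem fellow_travel_of_le (hgeo : GeodesicSpace X) (h : IsMorseAxis g f T M A B)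
    {β : ℝ → X} {L lam c K a b : ℝ} (hL : 0 ≤ L) (hlam : 1 ≤ lam) (hc : 0 ≤ c)
    (hβ : IsQuasiGeodesicOn β L lam c) (hab : a ≤ b)
    (h0 : dist (β 0) (f a) ≤ K) (h1 : dist (β L) (f b) ≤ K) {N : ℝ}
    (hN : N = M lam (c + 2 * K + 2 * lam * K)) :
    (∀ u ∈ Set.Icc 0 L, ∃ v ∈ Set.Icc a b, dist (β u) (f v) ≤ N) ∧
    ∀ w ∈ Set.Icc a b, ∃ u ∈ Set.Icc 0 L, dist (f w) (β u) ≤ N + A * (2 * N + 1) + B + K := by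
  have hK : 0 ≤ K := dist_nonneg.trans h0
  have hc' : 0 ≤ c + 2 * K + 2 * lam * K := by positivity
  obtain ⟨β', hβ', h0', h1', hmid, hclose⟩ := hβ.exists_extension hgeo hL hlam h0 h1
  have hnear := h.morse lam _ hlam hc' β' _ (by linarith) hβ' a b hab h0' h1'
  rw [← hN] at hnear
  constructor
  · intro u hu
    rw [← hmid u hu]
    exact hnear (K + u) ⟨by linarith [hu.1], by linarith [hu.2]⟩
  · intro w hw
    obtain ⟨t, ht, hd⟩ := h.exists_dist_le_of_near (by linarith) hβ'.1 h0' h1' hnear hw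
    obtain ⟨u, hu, hd'⟩ := hclose t ht
    exact ⟨u, hu, (dist_triangle _ _ _).trans (add_le_add hd hd')⟩

theorem fellow_travel (hgeo : GeodesicSpace X) (h : IsMorseAxis g f T M A B)
    {β : ℝ → X} {L lam c K a b : ℝ} (hL : 0 ≤ L) (hlam : 1 ≤ lam) (hc : 0 ≤ c)
    (hβ : IsQuasiGeodesicOn β L lam c)
    (h0 : dist (β 0) (f a) ≤ K) (h1 : dist (β L) (f b) ≤ K) {N : ℝ}
    (hN : N = M lam (c + 2 * K + 2 * lam * K)) :
    (∀ u ∈ Set.Icc 0 L, ∃ v ∈ Set.uIcc a b, dist (β u) (f v) ≤ N) ∧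
    ∀ w ∈ Set.uIcc a b, ∃ u ∈ Set.Icc 0 L, dist (f w) (β u) ≤ N + A * (2 * N + 1) + B + K := by
  rcases le_total a b with hab | hba
  · rw [Set.uIcc_of_le hab]
    exact h.fellow_travel_of_le hgeo hL hlam hc hβ hab h0 h1 hN
  · rw [Set.uIcc_of_ge hba]
    obtain ⟨h2, h3⟩ := h.fellow_travel_of_le hgeo hL hlam hc hβ.reverse hba
      (by simpa using h1) (by simpa using h0) hN
    refine ⟨fun u hu => ?_, fun w hw => ?_⟩
    · simpa using h2 (L - u) ⟨by linarith [hu.2], by linarith [hu.1]⟩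
    · obtain ⟨u, hu, hd⟩ := h3 w hw
      exact ⟨L - u, ⟨by linarith [hu.2], by linarith [hu.1]⟩, hd⟩

theorem not_isOfFinOrder (h : IsMorseAxis g f T M A B) : ¬ IsOfFinOrder g := by
  rw [isOfFinOrder_iff_pow_eq_one]
  rintro ⟨n, hn, hg⟩
  have hT := h.period_pos
  obtain ⟨m, hm⟩ := exists_nat_gt (B / T)
  rw [div_lt_iff₀ hT] at hm
  have h1 : f (0 + (n * m : ℕ) * T) = f 0 := by
    rw [h.equivariant_nat, pow_mul, hg, one_pow, one_smul]
  have h2 := h.le_dist 0 (0 + (n * m : ℕ) * T) (by positivity)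
  rw [h1, dist_self] at h2
  have h3 : (m : ℝ) * T ≤ (n * m : ℕ) * T := by
    apply mul_le_mul_of_nonneg_right _ hT.le
    exact_mod_cast Nat.le_mul_of_pos_left m hn
  linarith

theorem isStableSubgroup (hiso : IsometricAction G X) (hgeo : GeodesicSpace X)
    (h : IsMorseAxis g f T M A B) (o : X) : IsStableSubgroup o (Subgroup.zpowers g) := by
  have hT := h.period_pos
  set K := dist o (f 0) with hK
  set N := M 1 (0 + 2 * K + 2 * 1 * K) with hN
  set N' := M 1 (0 + 2 * N + 2 * 1 * N) with hN'
  refine ⟨fun lam c => M lam (c + 2 * N + 2 * lam * N) + (N' + A * (2 * N' + 1) + B + N),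
    |N| + T + K, by positivity, ?_⟩
  rintro _ ⟨k, rfl⟩ γ h0 h1 hγ
  set ℓ := dist o ((fun k : ℤ => g ^ k) k • o)
  have hend : dist (γ ℓ) (f (0 + k * T)) ≤ K := by
    rw [h1, h.equivariant_int, hiso]
  obtain ⟨hnear, -⟩ := h.fellow_travel hgeo dist_nonneg le_rfl le_rfl hγ.isQuasiGeodesicOn
    (a := 0) (K := K) (by rw [h0]) hend hN
  constructor
  · intro lam c hlam hc β L hL hβ s t hs hst ht hβ0 hβ1 u hu
    obtain ⟨p, -, hp⟩ := hnear s ⟨hs, hst.trans ht⟩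
    obtain ⟨q, -, hq⟩ := hnear t ⟨hs.trans hst, ht⟩
    obtain ⟨w, hw, hd⟩ := (h.fellow_travel hgeo hL hlam hc hβ (a := p) (b := q) (K := N) (by rwa [hβ0]) (by rwa [hβ1])
      rfl).1 u hu
    obtain ⟨v, hv, hd'⟩ := (h.fellow_travel hgeo (sub_nonneg.2 hst) le_rfl le_rfl
      (hγ.isQuasiGeodesicOn.subpath hs ht) (by simpa using hp) (by simpa using hq) hN').2 w hw
    refine ⟨s + v, ⟨by linarith [hv.1], by linarith [hv.2]⟩, ?_⟩
    exact (dist_triangle _ _ _).trans (add_le_add hd hd')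
  · intro s hs
    obtain ⟨v, -, hv⟩ := hnear s hs
    refine ⟨g ^ ⌊v / T⌋, ⟨_, rfl⟩, ?_⟩
    have h2 : f (0 + ⌊v / T⌋ * T) = g ^ ⌊v / T⌋ • f 0 := h.equivariant_int _ _
    have h3 : ⌊v / T⌋ * T ≤ v := by
      rw [← le_div_iff₀ hT]; exact Int.floor_le _
    have h4 : v < (⌊v / T⌋ + 1) * T := by
      rw [← div_lt_iff₀ hT]; exact Int.lt_floor_add_one _
    have h5 := h.dist_le (0 + ⌊v / T⌋ * T) v (by linarith)
    have h6 : dist (f (0 + ⌊v / T⌋ * T)) (g ^ ⌊v / T⌋ • o) = K := by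
      rw [h2, hiso, dist_comm]
    have h7 := dist_triangle4 (γ s) (f v) (f (0 + ⌊v / T⌋ * T)) (g ^ ⌊v / T⌋ • o)
    rw [dist_comm (f v)] at h7
    linarith [le_abs_self N]

theorem isMorseElement (hiso : IsometricAction G X) (hgeo : GeodesicSpace X)
    (h : IsMorseAxis g f T M A B) (o : X) : IsMorseElement o g :=
  ⟨h.not_isOfFinOrder, h.isStableSubgroup hiso hgeo o⟩

end IsMorseAxis

theorem IsMorseGeodesicRay.smul {X G : Type*} [MetricSpace X] [Group G] [MulAction G X]
    (hiso : IsometricAction G X) (g : G) {γ : ℝ → X} {M : ℝ → ℝ → ℝ}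
    (hγ : IsMorseGeodesicRay γ M) : IsMorseGeodesicRay (fun t => g • γ t) M := by
  refine ⟨fun s t hs ht => by rw [hiso]; exact hγ.1 s t hs ht, ?_⟩
  intro lam c hlam hc β L hL hβ s t hs hst h0 h1 u hu
  obtain ⟨v, hv, hd⟩ := hγ.2 lam c hlam hc _ L hL (hβ.smul hiso g⁻¹) s t hs hst
    (by simp [h0]) (by simp [h1]) u hu
  refine ⟨v, hv, ?_⟩
  rw [← hiso g⁻¹]; simpa using hd

/-- A path fellow-travelling a Morse geodesic ray is a Morse quasi-geodesic. -/
theorem IsMorseGeodesicRay.of_fellow_travel {X : Type*} [MetricSpace X] (hgeo : GeodesicSpace X)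
    {γ α : ℝ → X} {M : ℝ → ℝ → ℝ} (hγ : IsMorseGeodesicRay γ M) {L K t₀ : ℝ} (ht₀ : 0 ≤ t₀)
    (hα : IsShortOn α 0 L) (hclose : ∀ u ∈ Set.Icc 0 L, dist (α u) (γ (t₀ + u)) ≤ K) :
    IsQuasiGeodesicOn α L 1 (2 * K) ∧
      IsMorseOn α L (fun lam c => M lam (c + 2 * K + 2 * lam * K) + K) := by
  refine ⟨⟨hα, ?_⟩, ?_⟩
  · intro s t hs hst ht
    have h1 := hclose s ⟨hs, hst.trans ht⟩
    have h2 := hclose t ⟨hs.trans hst, ht⟩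
    have h3 := hγ.1 (t₀ + s) (t₀ + t) (by linarith) (by linarith)
    rw [abs_sub_comm, abs_of_nonneg (by linarith)] at h3
    have h4 := dist_triangle4 (γ (t₀ + s)) (α s) (α t) (γ (t₀ + t))
    rw [dist_comm _ (α s)] at h4
    linarith
  · intro lam c hlam hc β Lβ hLβ hβ s t hs hst ht hβ0 hβ1 u hu
    have h1 := hclose s ⟨hs, hst.trans ht⟩
    have h2 := hclose t ⟨hs.trans hst, ht⟩
    have hK : 0 ≤ K := dist_nonneg.trans h1
    rw [← hβ0] at h1
    rw [← hβ1] at h2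
    obtain ⟨β', hβ', h0', h1', hmid, -⟩ := hβ.exists_extension hgeo hLβ hlam h1 h2
    obtain ⟨v, hv, hd⟩ := hγ.2 lam _ hlam (by positivity) β' _ (by linarith) hβ' (t₀ + s) (t₀ + t)
      (by linarith) (by linarith) h0' h1' (K + u) ⟨by linarith [hu.1], by linarith [hu.2]⟩
    rw [hmid u hu] at hd
    refine ⟨v - t₀, ⟨by linarith [hv.1], by linarith [hv.2]⟩, ?_⟩
    have h3 := hclose (v - t₀) ⟨by linarith [hv.1], by linarith [hv.2]⟩
    rw [add_sub_cancel] at h3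
    have := dist_triangle (β u) (γ v) (α (v - t₀))
    rw [dist_comm (γ v)] at this
    linarith

theorem exists_equivariant_path {X G : Type*} [Group G] [MulAction G X] {g : G} {q : ℝ → X}
    {T : ℝ} (hT : 0 < T) (hq : q T = g • q 0) :
    ∃ p : ℝ → X, (∀ t, p (t + T) = g • p t) ∧ ∀ t ∈ Set.Icc 0 T, p t = q t := by
  refine ⟨fun t => g ^ ⌊t / T⌋ • q (t - ⌊t / T⌋ * T), fun t => ?_, fun t ht => ?_⟩
  · have : ⌊(t + T) / T⌋ = 1 + ⌊t / T⌋ := by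
      rw [add_div, div_self hT.ne', Int.floor_add_one, add_comm]
    simp only [this, zpow_add, zpow_one, mul_smul]
    congr 3
    push_cast; ring
  · rcases ht.2.eq_or_lt with rfl | h
    · simp [div_self hT.ne', hq]
    · have : ⌊t / T⌋ = 0 := by
        rw [Int.floor_eq_zero_iff]
        exact ⟨div_nonneg ht.1 hT.le, (div_lt_one hT).2 h⟩
      simp [this]

/-- By the pigeonhole principle, a long window of a geodesic ray is nearly translated by some
group element to a later window. -/
theorem exists_translate_window {X G : Type*} [MetricSpace X] [Group G] [MulAction G X] {o : X}
    (hiso : IsometricAction G X) (hproper : ProperAction G X) {γ : ℝ → X}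
    (hγ : ∀ s t : ℝ, 0 ≤ s → 0 ≤ t → dist (γ s) (γ t) = |s - t|) {a : ℕ → G} {K : ℝ}
    (ha : ∀ n : ℕ, dist (a n • o) (γ n) ≤ K) {R : ℕ} (hR : 0 < R) :
    ∃ (i j : ℕ) (g : G), i + R ≤ j ∧
      ∀ t ∈ Set.Icc (0 : ℝ) R, dist (g • γ (i + t)) (γ (j + t)) ≤ 2 * K + 2 := by
  have hK : 0 ≤ K := dist_nonneg.trans (ha 0)
  have hFfin : {g : G | dist o (g • o) ≤ 2 * K + R}.Finite := hproper o _ (by positivity)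
  have hpi : (Set.univ.pi fun _ : Fin (R + 1) => {g : G | dist o (g • o) ≤ 2 * K + R}).Finite :=
    Set.Finite.pi fun _ => hFfin
  have hmaps : Set.MapsTo (fun (m : ℕ) (r : Fin (R + 1)) => (a (R * m))⁻¹ * a (R * m + r))
      Set.univ (Set.univ.pi fun _ : Fin (R + 1) => {g : G | dist o (g • o) ≤ 2 * K + R}) := by
    intro m _ r _
    have hr : ((r : ℕ) : ℝ) ≤ R := by exact_mod_cast Nat.lt_succ_iff.1 r.2
    have h1 : dist o (((a (R * m))⁻¹ * a (R * m + r)) • o) =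
        dist (a (R * m) • o) (a (R * m + r) • o) := by
      rw [← hiso (a (R * m)) o, smul_smul, mul_inv_cancel_left]
    have h2 := ha (R * m)
    have h3 := ha (R * m + r)
    have h4 := hγ (R * m : ℕ) (R * m + r : ℕ) (by positivity) (by positivity)
    have h5 : |((R * m : ℕ) : ℝ) - (R * m + r : ℕ)| = (r : ℕ) := by
      push_cast
      rw [sub_add_cancel_left, abs_neg, Nat.abs_cast]
    have h6 := dist_triangle4 (a (R * m) • o) (γ (R * m : ℕ)) (γ (R * m + r : ℕ))
      (a (R * m + r) • o)
    rw [dist_comm (γ (R * m + r : ℕ))] at h6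
    show dist o _ ≤ _
    linarith
  obtain ⟨m₁, -, m₂, -, hne, heq⟩ :=
    Set.infinite_univ.exists_ne_map_eq_of_mapsTo hmaps hpi
  wlog hlt : m₁ < m₂ generalizing m₁ m₂
  · exact this m₂ m₁ hne.symm heq.symm (lt_of_le_of_ne (not_lt.1 hlt) hne.symm)
  refine ⟨R * m₁, R * m₂, a (R * m₂) * (a (R * m₁))⁻¹, ?_, ?_⟩
  · calc R * m₁ + R = R * (m₁ + 1) := by ring
      _ ≤ R * m₂ := Nat.mul_le_mul_left _ hlt
  · rintro t ⟨ht0, ht1⟩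
    set i := R * m₁
    set j := R * m₂
    set r := ⌊t⌋₊ with hr
    have hr1 : (r : ℝ) ≤ t := Nat.floor_le ht0
    have hr2 : t < r + 1 := Nat.lt_floor_add_one t
    have hrR : r < R + 1 := by
      have : (r : ℝ) ≤ R := hr1.trans ht1
      exact Nat.lt_succ_of_le (by exact_mod_cast this)
    have h1 : (a i)⁻¹ * a (i + r) = (a j)⁻¹ * a (j + r) := congrFun heq ⟨r, hrR⟩
    have h2 : a (j + r) = a j * (a i)⁻¹ * a (i + r) := by
      rw [mul_assoc, h1, mul_inv_cancel_left]
    have h3 : dist ((a j * (a i)⁻¹) • γ (i + t)) ((a j * (a i)⁻¹) • γ (i + r : ℕ)) ≤ 1 := by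
      rw [hiso, hγ _ _ (by positivity) (by positivity)]
      push_cast
      rw [abs_le]; constructor <;> linarith
    have h4 : dist ((a j * (a i)⁻¹) • γ (i + r : ℕ)) (a (j + r) • o) ≤ K := by
      rw [h2, mul_smul _ (a (i + r)), hiso, dist_comm]; exact ha _
    have h5 := ha (j + r)
    have h6 : dist (γ (j + r : ℕ)) (γ (j + t)) ≤ 1 := by
      rw [hγ _ _ (by positivity) (by positivity)]
      push_cast
      rw [abs_le]; constructor <;> linarith
    have h7 := dist_triangle4 ((a j * (a i)⁻¹) • γ (i + t)) ((a j * (a i)⁻¹) • γ (i + r : ℕ))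
      (a (j + r) • o) (γ (j + t))
    have h8 := dist_triangle (a (j + r) • o) (γ (j + r : ℕ)) (γ (j + t))
    linarith

theorem exists_isMorseAxis {X G : Type*} [MetricSpace X] [Group G] [MulAction G X] (o : X)
    (hiso : IsometricAction G X) (hproper : ProperAction G X)
    (hcocompact : CocompactAction G X)
    (hgeo : GeodesicSpace X) (hmltg : MorseLocalToGlobalSpace X)
    (hray : ∃ (γ : ℝ → X) (M : ℝ → ℝ → ℝ), IsMorseGeodesicRay γ M) :
    ∃ (g : G) (f : ℝ → X) (T : ℝ) (M : ℝ → ℝ → ℝ) (A B : ℝ), IsMorseAxis g f T M A B := by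
  obtain ⟨γ, M, hγ⟩ := hray
  obtain ⟨S, hS, hSG⟩ := hcocompact
  obtain ⟨K, hSK⟩ := hS.isBounded.subset_closedBall o
  have hex : ∀ n : ℕ, ∃ g : G, dist (g • o) (γ n) ≤ K := by
    intro n
    obtain ⟨g, hg⟩ := hSG (γ n)
    refine ⟨g⁻¹, ?_⟩
    rw [← hiso g, smul_inv_smul, dist_comm]
    exact hSK hg
  choose a ha using hex
  have hK : 0 ≤ K := dist_nonneg.trans (ha 0)
  set K₁ := 4 * K + 4 with hK₁
  obtain ⟨M', L, A, B, -, hA, -, hglob⟩ := hmltg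
    (fun lam c => M lam (c + 2 * K₁ + 2 * lam * K₁) + K₁) 1 (2 * K₁) le_rfl (by positivity)
  obtain ⟨i, j, g, hij, hg⟩ := exists_translate_window hiso hproper hγ.1 ha
    (R := ⌈L⌉₊ + 1) (Nat.succ_pos _)
  set R : ℝ := ((⌈L⌉₊ + 1 : ℕ) : ℝ) with hRdef
  have hR1 : 1 ≤ R := by rw [hRdef]; push_cast; linarith [Nat.cast_nonneg (α := ℝ) ⌈L⌉₊]
  have hRL : L ≤ R := by rw [hRdef]; push_cast; linarith [Nat.le_ceil L]
  have hi : (0 : ℝ) ≤ i := Nat.cast_nonneg _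
  have hij' : (i : ℝ) + R ≤ j := by rw [hRdef]; exact_mod_cast hij
  have hgeod : ∀ s t : ℝ, 0 ≤ s → s ≤ t → dist (γ s) (γ t) = t - s := by
    intro s t hs hst
    rw [hγ.1 s t hs (hs.trans hst), abs_sub_comm, abs_of_nonneg (by linarith)]
  set T : ℝ := j - i with hT
  set δ := dist (γ j) (g • γ i) with hδ
  have hδ0 : 0 ≤ δ := dist_nonneg
  have hδK : δ ≤ 2 * K + 2 := by
    have := hg 0 ⟨le_rfl, by linarith⟩
    rwa [add_zero, add_zero, dist_comm] at this
  obtain ⟨η, η0, η1, hη⟩ := hgeo.exists_short hδ.symm.le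
  obtain ⟨q, hq, q₁, q₂⟩ := exists_concat (f := fun t => γ (i + t)) (L₁ := T) (h := η) (L₂ := δ)
    (fun s t hs hst ht => by
      rw [hgeod _ _ (by linarith) (by linarith)]; linarith) hη
    (by rw [η0, hT, add_sub_cancel])
  obtain ⟨p, hp, hpq⟩ := exists_equivariant_path (g := g) (q := q) (T := T + δ) (by linarith)
    (by rw [q₂ _ (by linarith), q₁ 0 (by linarith), add_sub_cancel_left, η1, add_zero])
  have hp' : ∀ t, p t = g • p (t - (T + δ)) := fun t => by rw [← hp, sub_add_cancel]
  have hpshort : IsShortOn p 0 (2 * (T + δ)) := by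
    refine IsShortOn.trans (b := T + δ) ?_ ?_
    · intro s t hs hst ht
      rw [hpq s ⟨hs, hst.trans ht⟩, hpq t ⟨hs.trans hst, ht⟩]
      exact hq s t hs hst ht
    · intro s t hs hst ht
      rw [hp' s, hp' t, hiso, hpq _ ⟨by linarith, by linarith⟩, hpq _ ⟨by linarith, by linarith⟩]
      have := hq (s - (T + δ)) (t - (T + δ)) (by linarith) (by linarith) (by linarith)
      linarith
  have hclose : ∀ t ∈ Set.Icc 0 (T + δ + R), dist (p t) (γ (i + t)) ≤ K₁ := by
    rintro t ⟨ht0, ht1⟩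
    rcases le_total t T with h1 | h1
    · rw [hpq t ⟨ht0, by linarith⟩, q₁ t h1, dist_self]
      linarith
    rcases le_total t (T + δ) with h2 | h2
    · have h3 := hpshort T t (by linarith) h1 (by linarith)
      rw [hpq T ⟨by linarith, by linarith⟩, q₁ T le_rfl] at h3
      have h4 := hgeod (i + T) (i + t) (by linarith) (by linarith)
      have h5 := dist_triangle (p t) (γ (i + T)) (γ (i + t))
      rw [dist_comm (p t) (γ (i + T))] at h5
      linarith
    · rw [hp' t, hpq _ ⟨by linarith, by linarith⟩, q₁ _ (by linarith)]
      have h3 := hg (t - (T + δ)) ⟨by linarith, by linarith⟩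
      have h4 := hgeod (j + (t - (T + δ))) (i + t) (by linarith) (by linarith)
      have h5 := dist_triangle (g • γ (i + (t - (T + δ)))) (γ (j + (t - (T + δ)))) (γ (i + t))
      linarith
  have hpow : ∀ (k : ℤ) (t : ℝ), p (k * (T + δ) + t) = g ^ k • p t := by
    intro k
    induction k using Int.induction_on with
    | zero => simp
    | succ k ih =>
      intro t
      rw [add_comm (k : ℤ) 1, zpow_add, zpow_one, mul_smul, ← ih, ← hp]
      congr 1; push_cast; ring
    | pred k ih =>
      intro t
      rw [sub_eq_neg_add, zpow_add, zpow_neg_one, mul_smul, ← ih, eq_inv_smul_iff, ← hp]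
      congr 1; push_cast; ring
  have hlocal : ∀ s l : ℝ, 0 ≤ l → l ≤ R →
      IsQuasiGeodesicOn (fun u => p (s + u)) l 1 (2 * K₁) ∧
      IsMorseOn (fun u => p (s + u)) l
        (fun lam c => M lam (c + 2 * K₁ + 2 * lam * K₁) + K₁) := by
    intro s l hl hlR
    have hTpos : 0 < T + δ := by linarith
    set k := ⌊s / (T + δ)⌋ with hk
    set s₀ := s - k * (T + δ) with hs₀
    have hk1 : k * (T + δ) ≤ s := by
      rw [← le_div_iff₀ hTpos]; exact Int.floor_le _
    have hk2 : s < (k + 1) * (T + δ) := by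
      rw [← div_lt_iff₀ hTpos]; exact Int.lt_floor_add_one _
    have hps : ∀ u, p (s + u) = g ^ k • p (s₀ + u) := by
      intro u
      rw [← hpow]
      congr 1; rw [hs₀]; ring
    have hs0 : 0 ≤ s₀ := by linarith
    have hs1 : s₀ ≤ T + δ := by linarith
    refine (hγ.smul hiso (g ^ k)).of_fellow_travel hgeo (t₀ := i + s₀) (by linarith) ?_ ?_
    · intro u v hu huv hv
      simp only [hps, hiso (g ^ k)]
      have := hpshort (s₀ + u) (s₀ + v) (by linarith) (by linarith) (by linarith)
      linarith
    · intro u hu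
      simp only [hps, hiso (g ^ k), add_assoc]
      exact hclose _ ⟨by linarith [hu.1], by linarith [hu.2]⟩
  have hglobal : ∀ s t : ℝ, s ≤ t → IsQuasiGeodesicOn (fun u => p (s + u)) (t - s) A B ∧
      IsMorseOn (fun u => p (s + u)) (t - s) M' := by
    intro s t hst
    refine hglob _ _ (by linarith) ?_
    intro u v hu huv hv hL
    simpa only [add_assoc] using hlocal (s + u) (v - u) (by linarith) (by linarith)
  refine ⟨g, p, T + δ, M', A, B, by linarith, hA, hp, ?_, ?_, ?_⟩
  · intro s t hst
    simpa using (hglobal s t hst).1.1 0 (t - s) le_rfl (by linarith) le_rfl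
  · intro s t hst
    simpa using (hglobal s t hst).1.2 0 (t - s) le_rfl (by linarith) le_rfl
  · intro lam c hlam hc β Lβ hLβ hβ s t hst h0 h1 u hu
    obtain ⟨v, hv, hd⟩ := (hglobal s t hst).2 lam c hlam hc β Lβ hLβ hβ 0 (t - s) le_rfl
      (by linarith) le_rfl (by simpa using h0) (by simpa using h1) u hu
    exact ⟨s + v, ⟨by linarith [hv.1], by linarith [hv.2]⟩, hd⟩

/-- A long geodesic can be shortcut near its ends to a `(3, 0)`-quasi-geodesic with prescribed
nearby endpoints. -/
theorem IsGeodesicOn.exists_quasiGeodesic {X : Type*} [MetricSpace X] (hgeo : GeodesicSpace X)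
    {σ : ℝ → X} {ℓ C : ℝ} (hℓ : 0 ≤ ℓ) (hσ : IsGeodesicOn σ ℓ) {a b : X}
    (ha : dist a (σ 0) ≤ C) (hb : dist b (σ ℓ) ≤ C) (hab : 10 * C ≤ dist a b) :
    ∃ (β : ℝ → X) (L : ℝ), 0 ≤ L ∧ IsQuasiGeodesicOn β L 3 0 ∧ β 0 = a ∧ β L = b ∧
      ∀ t ∈ Set.Icc 0 L, dist a (β t) ≤ C ∨ dist b (β t) ≤ C ∨ ∃ s ∈ Set.Icc 0 ℓ, β t = σ s := by
  have hC : 0 ≤ C := dist_nonneg.trans ha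
  have hcont : ContinuousOn σ (Set.Icc 0 ℓ) := by
    refine (LipschitzOnWith.of_dist_le_mul (K := 1) fun s hs t ht => ?_).continuousOn
    rw [hσ s t hs ht, Real.dist_eq]; simp
  have hdist : ∀ s t, 0 ≤ s → s ≤ t → t ≤ ℓ → dist (σ s) (σ t) = t - s := by
    intro s t hs hst ht
    rw [hσ s t ⟨hs, hst.trans ht⟩ ⟨hs.trans hst, ht⟩, abs_sub_comm,
      abs_of_nonneg (sub_nonneg.2 hst)]
  have hnear : ∀ x : X, ∃ s ∈ Set.Icc 0 ℓ, ∀ t ∈ Set.Icc 0 ℓ, dist x (σ s) ≤ dist x (σ t) := by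
    intro x
    obtain ⟨s, hs, hmin⟩ := isCompact_Icc.exists_isMinOn (Set.nonempty_Icc.2 hℓ)
      ((continuous_const.dist continuous_id).comp_continuousOn hcont : ContinuousOn
        (fun t => dist x (σ t)) (Set.Icc 0 ℓ))
    exact ⟨s, hs, fun t ht => hmin ht⟩
  obtain ⟨p, hp, hpmin⟩ := hnear a
  obtain ⟨q, hq, hqmin⟩ := hnear b
  have hapC : dist a (σ p) ≤ C := (hpmin 0 ⟨le_rfl, hℓ⟩).trans ha
  have hbqC : dist b (σ q) ≤ C := (hqmin ℓ ⟨hℓ, le_rfl⟩).trans hb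
  have hp2 : p ≤ 2 * C := by
    have h1 := hdist 0 p le_rfl hp.1 hp.2
    have h2 := dist_triangle_left (σ 0) (σ p) a
    linarith
  have hq2 : ℓ - 2 * C ≤ q := by
    have h1 := hdist q ℓ hq.1 hq.2 le_rfl
    have h2 := dist_triangle_left (σ q) (σ ℓ) b
    linarith
  have hℓC : 8 * C ≤ ℓ := by
    have h1 := hdist 0 ℓ le_rfl hℓ le_rfl
    have h2 := dist_triangle4 a (σ 0) (σ ℓ) b
    rw [dist_comm (σ ℓ) b] at h2
    linarith
  have hpq : 4 * C ≤ q - p := by linarith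
  set l₁ := dist a (σ p) with hl₁
  set l₃ := dist b (σ q) with hl₃
  have hl₁0 : 0 ≤ l₁ := dist_nonneg
  have hl₃0 : 0 ≤ l₃ := dist_nonneg
  obtain ⟨η, η0, η1, hη⟩ := hgeo a (σ p)
  obtain ⟨ζ, ζ0, ζ1, hζ⟩ := hgeo (σ q) b
  rw [dist_comm (σ q) b, ← hl₃] at ζ1 hζ
  rw [← hl₁] at η1 hη
  have hη' : ∀ s t, 0 ≤ s → s ≤ t → t ≤ l₁ → dist (η s) (η t) = t - s := by
    intro s t hs hst ht
    rw [hη s t ⟨hs, hst.trans ht⟩ ⟨hs.trans hst, ht⟩, abs_sub_comm,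
      abs_of_nonneg (sub_nonneg.2 hst)]
  have hζ' : ∀ s t, 0 ≤ s → s ≤ t → t ≤ l₃ → dist (ζ s) (ζ t) = t - s := by
    intro s t hs hst ht
    rw [hζ s t ⟨hs, hst.trans ht⟩ ⟨hs.trans hst, ht⟩, abs_sub_comm,
      abs_of_nonneg (sub_nonneg.2 hst)]
  obtain ⟨k, hk, k₁, k₂⟩ := exists_concat (h := fun t => σ (p + t)) (L₂ := q - p)
    hη.isQuasiGeodesicOn.1
    (fun s t hs hst ht => by
      rw [hdist _ _ (by linarith [hp.1]) (by linarith) (by linarith [hq.2])]; linarith)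
    (by rw [η1, add_zero])
  obtain ⟨β, hβ, β₁, β₂⟩ := exists_concat (h := ζ) (L₂ := l₃) hk hζ.isQuasiGeodesicOn.1
    (by rw [k₂ _ (by linarith), ζ0]; congr 1; ring)
  have e₁ : ∀ t, t ≤ l₁ → β t = η t := fun t ht => by rw [β₁ t (by linarith), k₁ t ht]
  have e₂ : ∀ t, l₁ ≤ t → t ≤ l₁ + (q - p) → β t = σ (p + (t - l₁)) := fun t h1 h2 => by
    rw [β₁ t h2, k₂ t h1]
  have farη : ∀ s r, 0 ≤ s → s ≤ l₁ → r ∈ Set.Icc 0 ℓ → l₁ - s ≤ dist (η s) (σ r) := by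
    intro s r hs hs1 hr
    have h1 := hpmin r hr
    have h2 := hη' 0 s le_rfl hs hs1
    have h3 := dist_triangle a (η s) (σ r)
    rw [η0] at h2
    linarith
  have farζ : ∀ t r, 0 ≤ t → t ≤ l₃ → r ∈ Set.Icc 0 ℓ → t ≤ dist (σ r) (ζ t) := by
    intro t r ht ht1 hr
    have h1 := hqmin r hr
    have h2 := hζ' t l₃ ht ht1 le_rfl
    have h3 := dist_triangle b (ζ t) (σ r)
    rw [ζ1, dist_comm] at h2
    rw [dist_comm (ζ t)] at h3
    linarith
  refine ⟨β, l₁ + (q - p) + l₃, by linarith, ⟨hβ, ?_⟩, ?_, ?_, ?_⟩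
  · intro s t hs hst ht
    have hd0 : 0 ≤ dist (β s) (β t) := dist_nonneg
    rcases le_total t l₁ with ht1 | ht1
    · rw [e₁ s (hst.trans ht1), e₁ t ht1, hη' s t hs hst ht1]
      linarith
    rcases le_total t (l₁ + (q - p)) with ht2 | ht2
    · rw [e₂ t ht1 ht2]
      rcases le_total s l₁ with hs1 | hs1
      · rw [e₁ s hs1]
        have h1 := farη s (p + (t - l₁)) hs hs1 ⟨by linarith [hp.1], by linarith [hq.2]⟩
        have h2 := hη' s l₁ hs hs1 le_rfl
        have h3 := hdist p (p + (t - l₁)) hp.1 (by linarith) (by linarith [hq.2])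
        have h4 := dist_triangle_left (σ p) (σ (p + (t - l₁))) (η s)
        rw [η1] at h2
        linarith
      · rw [e₂ s hs1 (hst.trans ht2),
          hdist _ _ (by linarith [hp.1]) (by linarith) (by linarith [hq.2])]
        linarith
    · rw [β₂ t ht2]
      have h5 := hζ' 0 (t - (l₁ + (q - p))) le_rfl (by linarith) (by linarith)
      rw [ζ0] at h5
      rcases le_total s l₁ with hs1 | hs1
      · rw [e₁ s hs1]
        have h2 := hη' s l₁ hs hs1 le_rfl
        have h3 := hdist p q hp.1 (by linarith) hq.2
        have h4 := dist_triangle4 (σ p) (η s) (ζ (t - (l₁ + (q - p)))) (σ q)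
        rw [η1] at h2
        rw [dist_comm (σ p) (η s), dist_comm (ζ _) (σ q)] at h4
        linarith
      rcases le_total s (l₁ + (q - p)) with hs2 | hs2
      · rw [e₂ s hs1 hs2]
        have h1 := farζ (t - (l₁ + (q - p))) (p + (s - l₁)) (by linarith) (by linarith)
          ⟨by linarith [hp.1], by linarith [hq.2]⟩
        have h3 := hdist (p + (s - l₁)) q (by linarith [hp.1]) (by linarith) hq.2
        have h4 := dist_triangle_right (σ (p + (s - l₁))) (σ q) (ζ (t - (l₁ + (q - p))))
        linarith
      · rw [β₂ s hs2, hζ' _ _ (by linarith) (by linarith) (by linarith)]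
        linarith
  · rw [e₁ 0 hl₁0, η0]
  · rw [β₂ _ (by linarith), add_sub_cancel_left, ζ1]
  · rintro t ⟨ht0, ht1⟩
    rcases le_total t l₁ with h1 | h1
    · left
      rw [e₁ t h1, ← η0, hη' 0 t le_rfl ht0 h1]
      linarith
    rcases le_total t (l₁ + (q - p)) with h2 | h2
    · right; right
      exact ⟨_, ⟨by linarith [hp.1], by linarith [hq.2]⟩, e₂ t h1 h2⟩
    · right; left
      rw [β₂ t h2, dist_comm, ← ζ1, hζ' _ _ (by linarith) (by linarith) le_rfl]
      linarith

/-- If a power of `g` lies in a stable subgroup `H`, then the axis of `g` passes uniformly close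
to the orbit of `H`. -/
theorem IsMorseAxis.exists_dist_le_of_pow_mem {X G : Type*} [MetricSpace X] [Group G]
    [MulAction G X] (hiso : IsometricAction G X) (hgeo : GeodesicSpace X) {g : G} {f : ℝ → X}
    {T : ℝ} {M : ℝ → ℝ → ℝ} {A B : ℝ} (h : IsMorseAxis g f T M A B) {o : X} {H : Subgroup G}
    {D : ℝ} (hD : ∀ h ∈ H, ∀ γ : ℝ → X, γ 0 = o → γ (dist o (h • o)) = h • o →
      IsGeodesicOn γ (dist o (h • o)) →
        ∀ s ∈ Set.Icc 0 (dist o (h • o)), ∃ h' ∈ H, dist (γ s) (h' • o) ≤ D)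
    {n : ℕ} (hn : 0 < n) (hg : g ^ n ∈ H) :
    ∃ h' ∈ H, dist (f 0) (h' • o) ≤ M 3 0 + A * (2 * M 3 0 + 1) + B + D := by
  have hT := h.period_pos
  have hA := h.one_le
  set E := M 3 0 + A * (2 * M 3 0 + 1) + B with hE
  set C := dist o (f 0) with hC
  have hC0 : 0 ≤ C := dist_nonneg
  obtain ⟨k, hk⟩ := exists_nat_gt ((A * (|E| + 10 * C + 1) + |B|) / T)
  rw [div_lt_iff₀ hT] at hk
  set S : ℝ := (n * k : ℕ) * T with hS
  have hkS : k * T ≤ S := by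
    apply mul_le_mul_of_nonneg_right _ hT.le
    exact_mod_cast Nat.le_mul_of_pos_left k hn
  have hAE : 0 ≤ A * (|E| + 10 * C + 1) := by positivity
  have hS0 : 0 ≤ S := by linarith [abs_nonneg B]
  have hlarge : ∀ x y : ℝ, x ≤ y → S ≤ y - x → |E| + 10 * C + 1 < dist (f x) (f y) := by
    intro x y hxy hSxy
    have h1 := h.le_dist x y hxy
    refine lt_of_mul_lt_mul_left (a := A) ?_ (by linarith)
    linarith [le_abs_self B]
  have hw : g ^ (n * k) ∈ H := by rw [pow_mul]; exact H.pow_mem hg k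
  set w := g ^ (n * k) with hwdef
  have hfS : f S = w • f 0 := by rw [← h.equivariant_nat, zero_add]
  have hfS' : f (-S) = w⁻¹ • f 0 := by
    rw [eq_inv_smul_iff, ← h.equivariant_nat, ← hS, neg_add_cancel]
  obtain ⟨τ, τ0, τ1, hτ⟩ := hgeo o ((w * w) • o)
  have hτD := hD (w * w) (H.mul_mem hw hw) τ τ0 τ1 hτ
  set ℓ := dist o ((w * w) • o) with hℓ
  have hσ : IsGeodesicOn (fun t => w⁻¹ • τ t) ℓ := fun s t hs ht => by rw [hiso]; exact hτ s t hs ht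
  obtain ⟨β, L, hL, hβ, β0, β1, hcases⟩ := hσ.exists_quasiGeodesic hgeo dist_nonneg
    (a := f (-S)) (b := f S) (C := C)
    (by rw [hfS', hiso, τ0, dist_comm])
    (by rw [hfS, τ1, mul_smul, inv_smul_smul, hiso, dist_comm])
    (by linarith [hlarge (-S) S (by linarith) (by linarith), abs_nonneg E])
  obtain ⟨u, hu, hd⟩ := h.exists_dist_le_of_near hL hβ.1 β0 β1
    (h.morse 3 0 (by norm_num) le_rfl β L hL hβ (-S) S (by linarith) β0 β1)
    (w := 0) ⟨by linarith, hS0⟩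
  rw [← hE] at hd
  rcases hcases u hu with h1 | h1 | ⟨s, hs, h1⟩
  · have h2 := hlarge (-S) 0 (by linarith) (by linarith)
    have h3 := dist_triangle_right (f (-S)) (f 0) (β u)
    linarith [le_abs_self E]
  · have h2 := hlarge 0 S (by linarith) (by linarith)
    have h3 := dist_triangle_right (f 0) (f S) (β u)
    linarith [le_abs_self E]
  · obtain ⟨h', hh', hd'⟩ := hτD s hs
    refine ⟨w⁻¹ * h', H.mul_mem (H.inv_mem hw) hh', ?_⟩
    have h2 : dist (β u) ((w⁻¹ * h') • o) ≤ D := by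
      rw [h1, mul_smul, hiso]; exact hd'
    exact (dist_triangle _ _ _).trans (add_le_add hd h2)

/-- A subgroup whose orbit is coarsely dense in the orbit of the whole group has finite index. -/
theorem Subgroup.index_ne_zero_of_forall_exists_dist_le {X G : Type*} [MetricSpace X] [Group G]
    [MulAction G X] (hiso : IsometricAction G X) (hproper : ProperAction G X) {o : X}
    {H : Subgroup G} {C : ℝ} (hC : ∀ x : G, ∃ h ∈ H, dist (x • o) (h • o) ≤ C) :
    H.index ≠ 0 := by
  have hfin : {g : G | dist o (g • o) ≤ |C| + 1}.Finite := hproper o _ (by positivity)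
  have : Finite {g : G | dist o (g • o) ≤ |C| + 1} := hfin
  have hsurj : Function.Surjective
      fun f : {g : G | dist o (g • o) ≤ |C| + 1} => (QuotientGroup.mk (f : G) : G ⧸ H) := by
    intro x
    obtain ⟨x, rfl⟩ := QuotientGroup.mk_surjective x
    obtain ⟨h, hh, hd⟩ := hC x⁻¹
    refine ⟨⟨x * h, ?_⟩, ?_⟩
    · show dist o ((x * h) • o) ≤ _
      rw [← hiso x⁻¹, smul_smul, inv_mul_cancel_left]
      linarith [le_abs_self C]
    · rw [QuotientGroup.eq]
      simpa using hh
  have := Finite.of_surjective _ hsurj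
  exact Subgroup.index_ne_zero_of_finite

theorem finite_setOf_zpow_near {X G : Type*} [MetricSpace X] [Group G] [MulAction G X]
    (hiso : IsometricAction G X) (hproper : ProperAction G X) {o : X} {H : Subgroup G} {g : G}
    (hg : ∀ n : ℕ, 0 < n → g ^ n ∉ H) (C : ℝ) :
    {k : ℤ | ∃ h ∈ H, dist (h • o) (g ^ k • o) ≤ C}.Finite := by
  by_contra hinf
  have hfin : {x : G | dist o (x • o) ≤ |C| + 1}.Finite := hproper o _ (by positivity)
  choose! φ hφ hd using fun (k : ℤ) (hk : k ∈ {k : ℤ | ∃ h ∈ H, dist (h • o) (g ^ k • o) ≤ C}) => hk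
  obtain ⟨k, hk, l, hl, hne, heq⟩ := Set.Infinite.exists_ne_map_eq_of_mapsTo hinf
    (f := fun k => (φ k)⁻¹ * g ^ k) (t := {x : G | dist o (x • o) ≤ |C| + 1}) (fun k hk => by
      show dist o (((φ k)⁻¹ * g ^ k) • o) ≤ _
      rw [← hiso (φ k), smul_smul, mul_inv_cancel_left]
      linarith [hd k hk, le_abs_self C]) hfin
  have hmem : g ^ (k - l) ∈ H := by
    have h1 : g ^ (k - l) = φ k * (φ l)⁻¹ := by
      have h2 : g ^ k = φ k * ((φ l)⁻¹ * g ^ l) := by rw [← heq, mul_inv_cancel_left]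
      rw [zpow_sub, h2]; group
    rw [h1]
    exact H.mul_mem (hφ k hk) (H.inv_mem (hφ l hl))
  refine hg (k - l).natAbs (Int.natAbs_pos.2 (sub_ne_zero.2 hne)) ?_
  rcases Int.natAbs_eq (k - l) with h1 | h1
  · rw [h1, zpow_natCast] at hmem; exact hmem
  · rw [h1, zpow_neg, zpow_natCast, H.inv_mem_iff] at hmem; exact hmem

/-- For an infinite-index stable subgroup `H` of a group acting geometrically
on a proper geodesic Morse local-to-global space with a Morse geodesic ray, there exists a
Morse element whose powers escape every bounded neighborhood of the orbit `H • o`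
(metric formulation of `Fix_{∂_M X}(g) ∩ Λ_M H = ∅`). -/
theorem exists_morse_element_transverse_to_stable_subgroup
    {X G : Type*} [MetricSpace X] [ProperSpace X] [Group G] [MulAction G X] (o : X)
    (hiso : IsometricAction G X) (hproper : ProperAction G X)
    (hcocompact : CocompactAction G X)
    (hgeo : GeodesicSpace X) (hmltg : MorseLocalToGlobalSpace X)
    (hray : ∃ (γ : ℝ → X) (M : ℝ → ℝ → ℝ), IsMorseGeodesicRay γ M)
    (hnonelem : ¬ VirtuallyCyclic G)
    (H : Subgroup G) (hstable : IsStableSubgroup o H) (hinf : H.index = 0) :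
    ∃ g : G, IsMorseElement o g ∧
      ∀ C : ℝ, 0 ≤ C → {k : ℤ | ∃ h ∈ H, dist (h • o) (g ^ k • o) ≤ C}.Finite := by
  obtain ⟨g, f, T, M, A, B, hf⟩ := exists_isMorseAxis o hiso hproper hcocompact hgeo hmltg hray
  obtain ⟨_, D, -, hD⟩ := hstable
  by_contra hcon
  have hpow : ∀ x : G, ∃ n : ℕ, 0 < n ∧ (x * g * x⁻¹) ^ n ∈ H := by
    intro x
    by_contra! hx
    exact hcon ⟨x * g * x⁻¹, (hf.conj hiso x).isMorseElement hiso hgeo o,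
      fun C _ => finite_setOf_zpow_near hiso hproper hx C⟩
  refine Subgroup.index_ne_zero_of_forall_exists_dist_le hiso hproper (o := o) (H := H)
    (C := dist o (f 0) + (M 3 0 + A * (2 * M 3 0 + 1) + B + D)) (fun x => ?_) hinf
  obtain ⟨n, hn, hx⟩ := hpow x
  obtain ⟨h, hh, hd⟩ := (hf.conj hiso x).exists_dist_le_of_pow_mem hiso hgeo
    (fun h hh γ h0 h1 hγ => (hD h hh γ h0 h1 hγ).2) hn hx
  refine ⟨h, hh, (dist_triangle _ (x • f 0) _).trans (add_le_add ?_ hd)⟩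
  rw [hiso]
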